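/- Consider the set 𝒢 of congestion games with at most n users and resource cost functions in 𝓛 for positive, convex basis functions b_1,…,b_m. For each j define F^mc_j(x) = x·b_j(x) − (x−1)·b_j(x−1) for x ∈ {1,…,n}, with the conventions b_j(0) = 0 and F^mc_j(0) = F^mc_j(n+1) = 0. Let ρ^mc be the optimal value of the linear program: maximize ρ over ρ ∈ ℝ and ν ≥ 0, subject to b_j(y)·y − ρ·b_j(x)·x + ν·[(x−z)·F^mc_j(x) − (y−z)·F^mc_j(x+1)] ≥ 0 for every j ∈ {1,…,m} and all integers x, y ∈ {0,…,n} with x+y ≥ 1, where z = max{0, x+y−n}. Then the marginal cost mechanism satisfies PoA(T^mc) = 1/ρ^mc. -/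

import Mathlib

open scoped BigOperators ENNReal

noncomputable section

/-- A congestion game with incentives: `n` users, `R` resources,
finite nonempty action sets `act i ⊆ 2^E`, resource cost functions `cost e`
and incentive functions `tax e`. -/
structure CGame where
  n : ℕ
  R : ℕ
  act : Fin n → Finset (Finset (Fin R))
  act_ne : ∀ i, (act i).Nonempty
  cost : Fin R → ℕ → ℝ
  tax : Fin R → ℕ → ℝ

namespace CGame

variable (G : CGame)

/-- An assignment of actions (not necessarily feasible). -/
abbrev Assign := Fin G.n → Finset (Fin G.R)

/-- Feasibility of an assignment. -/
def IsAssign (a : G.Assign) : Prop := ∀ i, a i ∈ G.act i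

/-- The load `|a|_e`: the number of users selecting resource `e`. -/
def load (a : G.Assign) (e : Fin G.R) : ℕ :=
  (Finset.univ.filter fun i => e ∈ a i).card

/-- The social cost `SC(a)`. -/
def SC (a : G.Assign) : ℝ := ∑ i, ∑ e ∈ a i, G.cost e (G.load a e)

/-- The cost `C_i(a)` experienced by user `i` (resource costs plus incentives). -/
def userCost (i : Fin G.n) (a : G.Assign) : ℝ :=
  ∑ e ∈ a i, (G.cost e (G.load a e) + G.tax e (G.load a e))

/-- Pure Nash equilibrium. -/
def IsNE (a : G.Assign) : Prop :=
  G.IsAssign a ∧ ∀ i : Fin G.n, ∀ s ∈ G.act i,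
    G.userCost i a ≤ G.userCost i (Function.update a i s)

/-- The Rosenthal potential of the game with incentives. -/
def potential (a : G.Assign) : ℝ :=
  ∑ e, ∑ k ∈ Finset.Icc 1 (G.load a e), (G.cost e k + G.tax e k)

/-- The minimum achievable social cost. -/
def MinCost : ℝ := sInf {c | ∃ a, G.IsAssign a ∧ G.SC a = c}

end CGame

/-- A (local) incentive mechanism: a map from resource cost functions to
incentive functions. -/
abbrev Mech : Type := (ℕ → ℝ) → (ℕ → ℝ)

/-- Membership of a game in the class `𝒢` of congestion games with at most `n`
users, resource cost functions that are nonnegative linear combinations of the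
basis functions `b`, and incentives generated by the mechanism `T`. -/
def InClass (n m : ℕ) (b : Fin m → ℕ → ℝ) (T : Mech) (G : CGame) : Prop :=
  G.n ≤ n ∧
  (∀ e, ∃ α : Fin m → ℝ, (∀ j, 0 ≤ α j) ∧ ∀ x, G.cost e x = ∑ j, α j * b j x) ∧
  (∀ e x, G.tax e x = T (G.cost e) x)

/-- Price of anarchy of mechanism `T` over the class of congestion games with
at most `n` users and costs generated by the basis `b`. -/
def PoA (n m : ℕ) (b : Fin m → ℕ → ℝ) (T : Mech) : ℝ≥0∞ :=
  ⨆ G : CGame, ⨆ _ : InClass n m b T G ∧ 0 < G.MinCost,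
    ⨆ a : G.Assign, ⨆ _ : G.IsNE a, ENNReal.ofReal (G.SC a / G.MinCost)

/-- Price of stability of mechanism `T` over the class of congestion games with
at most `n` users and costs generated by the basis `b`. -/
def PoS (n m : ℕ) (b : Fin m → ℕ → ℝ) (T : Mech) : ℝ≥0∞ :=
  ⨆ G : CGame, ⨆ _ : InClass n m b T G ∧ 0 < G.MinCost,
    ⨅ a : {a : G.Assign // G.IsNE a}, ENNReal.ofReal (G.SC a.1 / G.MinCost)

/-- The marginal cost mechanism `T^mc(ℓ)(x) = (x−1)·[ℓ(x) − ℓ(x−1)]`. -/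
def Tmc : Mech := fun ℓ x => ((x : ℝ) - 1) * (ℓ x - ℓ (x - 1))

/-- The marginal contribution `x·ℓ(x) − (x−1)·ℓ(x−1)` of the `x`-th user. -/
def marginal (f : ℕ → ℝ) (x : ℕ) : ℝ := (x : ℝ) * f x - ((x : ℝ) - 1) * f (x - 1)

theorem add_Tmc_eq_marginal (f : ℕ → ℝ) (x : ℕ) : f x + Tmc f x = marginal f x := by
  simp only [Tmc, marginal]; ring

theorem marginal_sum {ι : Type*} (s : Finset ι) (α : ι → ℝ) (f : ι → ℕ → ℝ) (x : ℕ) :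
    marginal (fun k => ∑ j ∈ s, α j * f j k) x = ∑ j ∈ s, α j * marginal (f j) x := by
  simp only [marginal, Finset.mul_sum, ← Finset.sum_sub_distrib]
  exact Finset.sum_congr rfl fun j _ => by ring

theorem marginal_mul (c : ℝ) (f : ℕ → ℝ) (x : ℕ) :
    marginal (fun k => c * f k) x = c * marginal f x := by
  simp only [marginal]; ring

section Convex

variable {n : ℕ} {f : ℕ → ℝ}

theorem increment_pos_of_convex (h0 : f 0 = 0) (hpos : ∀ x, 1 ≤ x → x ≤ n → 0 < f x)
    (hconv : ∀ x, 1 ≤ x → x + 1 ≤ n → f x - f (x - 1) ≤ f (x + 1) - f x)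
    (x : ℕ) (hx : x + 1 ≤ n) : f x < f (x + 1) := by
  induction x with
  | zero => rw [h0]; exact hpos 1 le_rfl hx
  | succ k ih =>
    have h1 := ih (by omega)
    have h2 := hconv (k + 1) (by omega) hx
    simp only [Nat.add_sub_cancel] at h2
    linarith

theorem marginal_le_succ (h0 : f 0 = 0) (hpos : ∀ x, 1 ≤ x → x ≤ n → 0 < f x)
    (hconv : ∀ x, 1 ≤ x → x + 1 ≤ n → f x - f (x - 1) ≤ f (x + 1) - f x)
    (x : ℕ) (hx : x + 1 ≤ n) : marginal f x ≤ marginal f (x + 1) := by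
  cases x with
  | zero =>
    have := hpos 1 le_rfl hx
    simp [marginal, h0, this.le]
  | succ k =>
    have h1 := increment_pos_of_convex h0 hpos hconv k (by omega)
    have h2 := increment_pos_of_convex h0 hpos hconv (k + 1) hx
    have h3 := hconv (k + 1) (by omega) hx
    simp only [Nat.add_sub_cancel] at h3
    simp only [marginal, Nat.add_sub_cancel]
    push_cast
    have hk : (0 : ℝ) ≤ (k : ℝ) := Nat.cast_nonneg k
    nlinarith [mul_nonneg hk (sub_nonneg.2 h3)]

theorem marginal_pos (h0 : f 0 = 0) (hpos : ∀ x, 1 ≤ x → x ≤ n → 0 < f x)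
    (hconv : ∀ x, 1 ≤ x → x + 1 ≤ n → f x - f (x - 1) ≤ f (x + 1) - f x)
    (x : ℕ) (hx1 : 1 ≤ x) (hx : x ≤ n) : 0 < marginal f x := by
  obtain ⟨k, rfl⟩ := Nat.exists_eq_add_of_le' hx1
  have h1 := increment_pos_of_convex h0 hpos hconv k hx
  have h2 := hpos (k + 1) hx1 hx
  simp only [marginal, Nat.add_sub_cancel]
  push_cast
  have hk : (0 : ℝ) ≤ (k : ℝ) := Nat.cast_nonneg k
  nlinarith

theorem apply_one_le_of_convex (h0 : f 0 = 0) (hpos : ∀ x, 1 ≤ x → x ≤ n → 0 < f x)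
    (hconv : ∀ x, 1 ≤ x → x + 1 ≤ n → f x - f (x - 1) ≤ f (x + 1) - f x)
    (x : ℕ) (hx1 : 1 ≤ x) (hx : x ≤ n) : f 1 ≤ f x := by
  induction x, hx1 using Nat.le_induction with
  | base => exact le_rfl
  | succ k _ ih =>
    exact (ih (by omega)).trans (increment_pos_of_convex h0 hpos hconv k hx).le

end Convex

/-- A theorem of the alternative for linear systems in one nonnegative variable. -/
theorem exists_weights_of_infeasible {ι : Type*} [Fintype ι] [DecidableEq ι] (d B : ι → ℝ)
    (h : ∀ ν : ℝ, 0 ≤ ν → ∃ i, d i + ν * B i < 0) :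
    ∃ θ : ι → ℝ, (∀ i, 0 ≤ θ i) ∧ ∑ i, θ i * B i ≤ 0 ∧ ∑ i, θ i * d i < 0 := by
  by_cases hs : ∃ i, B i ≤ 0 ∧ d i < 0
  · obtain ⟨i, hB, hd⟩ := hs
    refine ⟨Pi.single i 1, fun k => ?_, ?_, ?_⟩
    · by_cases hk : k = i
      · subst hk; simp
      · simp [hk]
    · simpa [Pi.single_apply] using hB
    · simpa [Pi.single_apply] using hd
  · push Not at hs
    obtain ⟨i, hi⟩ := h 0 le_rfl
    simp only [zero_mul, add_zero] at hi
    have hBi : 0 < B i := by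
      by_contra hcon
      exact absurd (hs i (not_lt.1 hcon)) (not_le.2 hi)
    obtain ⟨p, hp, hmax⟩ := Finset.exists_max_image (Finset.univ.filter fun i => 0 < B i)
      (fun i => -d i / B i) ⟨i, by simp [hBi]⟩
    have hBp : 0 < B p := by simpa using hp
    have hν : 0 ≤ -d p / B p :=
      (div_pos (neg_pos.2 hi) hBi).le.trans (hmax i (by simp [hBi]))
    obtain ⟨k, hk⟩ := h _ hν
    have hBk : B k ≤ 0 := by
      by_contra hcon
      push Not at hcon
      have h1 := hmax k (by simp [hcon])
      rw [div_le_iff₀ hcon] at h1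
      linarith
    refine ⟨Pi.single p (-B k) + Pi.single k (B p), fun i => ?_, ?_, ?_⟩
    · have h1 : (0 : ι → ℝ) ≤ Pi.single p (-B k) := Pi.single_nonneg.2 (by linarith)
      have h2 : (0 : ι → ℝ) ≤ Pi.single k (B p) := Pi.single_nonneg.2 hBp.le
      exact add_nonneg (h1 i) (h2 i)
    · simp [Pi.single_apply, add_mul, Finset.sum_add_distrib]
      linarith
    · simp only [Pi.add_apply, Pi.single_apply, add_mul, Finset.sum_add_distrib, ite_mul,
        zero_mul, Finset.sum_ite_eq', Finset.mem_univ, if_true]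
      have h1 : d p = -(-d p / B p * B p) := by field_simp
      rw [h1]
      nlinarith

namespace CGame

variable (G : CGame)

theorem sum_users_eq_sum_resources (a : G.Assign) (u : Fin G.R → ℝ) :
    ∑ i, ∑ e ∈ a i, u e = ∑ e, (G.load a e : ℝ) * u e := by
  have h : ∀ i, ∑ e ∈ a i, u e = ∑ e, if e ∈ a i then u e else 0 := fun i => by
    rw [← Finset.sum_filter]; simp
  simp only [h]
  rw [Finset.sum_comm]
  refine Finset.sum_congr rfl fun e _ => ?_
  rw [← Finset.sum_filter, Finset.sum_const, nsmul_eq_mul, load]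

theorem SC_eq_sum_resources (a : G.Assign) :
    G.SC a = ∑ e, (G.load a e : ℝ) * G.cost e (G.load a e) :=
  G.sum_users_eq_sum_resources a _

theorem load_update (a : G.Assign) (i : Fin G.n) (s : Finset (Fin G.R)) (e : Fin G.R)
    (he : e ∈ s) :
    G.load (Function.update a i s) e = if e ∈ a i then G.load a e else G.load a e + 1 := by
  have h : (Finset.univ.filter fun k => e ∈ Function.update a i s k)
      = insert i (Finset.univ.filter fun k => e ∈ a k) := by
    ext k
    by_cases hk : k = i
    · subst hk; simp [he]
    · simp [hk]
  simp only [load, h]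
  split_ifs with hi
  · rw [Finset.insert_eq_of_mem (by simp [hi])]
  · rw [Finset.card_insert_of_notMem (by simp [hi])]

theorem userCost_update (a : G.Assign) (i : Fin G.n) (s : Finset (Fin G.R))
    (F : Fin G.R → ℕ → ℝ) (hF : ∀ e x, G.cost e x + G.tax e x = F e x) :
    G.userCost i (Function.update a i s) =
      ∑ e, ((if e ∈ a i ∧ e ∈ s then F e (G.load a e) - F e (G.load a e + 1) else 0)
        + if e ∈ s then F e (G.load a e + 1) else 0) := by
  simp only [userCost, Function.update_self, hF]
  have h : ∀ u : Fin G.R → ℝ, ∑ e ∈ s, u e = ∑ e, if e ∈ s then u e else 0 := fun u => by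
    rw [← Finset.sum_filter]; simp
  rw [h]
  refine Finset.sum_congr rfl fun e _ => ?_
  by_cases he : e ∈ s
  · rw [load_update G a i s e he]
    by_cases hi : e ∈ a i <;> simp [he, hi]
  · simp [he]

/-- The number of users selecting `e` in both assignments. -/
def overlap (a a' : G.Assign) (e : Fin G.R) : ℕ :=
  (Finset.univ.filter fun i => e ∈ a i ∧ e ∈ a' i).card

theorem overlap_le_left (a a' : G.Assign) (e : Fin G.R) : G.overlap a a' e ≤ G.load a e :=
  Finset.card_le_card fun i => by simp +contextual

theorem overlap_le_right (a a' : G.Assign) (e : Fin G.R) : G.overlap a a' e ≤ G.load a' e :=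
  Finset.card_le_card fun i => by simp +contextual

theorem load_le (a : G.Assign) (e : Fin G.R) : G.load a e ≤ G.n := by
  simpa [load] using Finset.card_le_univ (Finset.univ.filter fun i => e ∈ a i)

theorem load_add_load_le (a a' : G.Assign) (e : Fin G.R) :
    G.load a e + G.load a' e ≤ G.overlap a a' e + G.n := by
  have h := Finset.card_union_add_card_inter (Finset.univ.filter fun i => e ∈ a i)
    (Finset.univ.filter fun i => e ∈ a' i)
  have h2 := Finset.card_le_univ ((Finset.univ.filter fun i => e ∈ a i) ∪
    (Finset.univ.filter fun i => e ∈ a' i))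
  rw [← Finset.filter_and] at h
  simp only [Fintype.card_fin] at h2
  simp only [load, overlap]
  omega

theorem sum_userCost_update (a a' : G.Assign)
    (F : Fin G.R → ℕ → ℝ) (hF : ∀ e x, G.cost e x + G.tax e x = F e x) :
    ∑ i, G.userCost i (Function.update a i (a' i)) =
      ∑ e, ((G.overlap a a' e : ℝ) * F e (G.load a e)
        + ((G.load a' e : ℝ) - G.overlap a a' e) * F e (G.load a e + 1)) := by
  simp only [G.userCost_update a _ _ F hF]
  rw [Finset.sum_comm]
  refine Finset.sum_congr rfl fun e _ => ?_
  rw [Finset.sum_add_distrib, ← Finset.sum_filter, ← Finset.sum_filter, Finset.sum_const,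
    Finset.sum_const, nsmul_eq_mul, nsmul_eq_mul]
  simp only [load, overlap]
  ring

/-- The aggregated equilibrium conditions for deviations towards `a'`. -/
theorem IsNE.sum_le {G : CGame} {a a' : G.Assign} (ha : G.IsNE a) (ha' : G.IsAssign a')
    (F : Fin G.R → ℕ → ℝ) (hF : ∀ e x, G.cost e x + G.tax e x = F e x) :
    ∑ e, (((G.load a e : ℝ) - G.overlap a a' e) * F e (G.load a e)
      - ((G.load a' e : ℝ) - G.overlap a a' e) * F e (G.load a e + 1)) ≤ 0 := by
  have h1 : ∑ i, G.userCost i a ≤ ∑ i, G.userCost i (Function.update a i (a' i)) :=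
    Finset.sum_le_sum fun i _ => ha.2 i _ (ha' i)
  rw [G.sum_userCost_update a a' F hF] at h1
  have h2 : ∑ i, G.userCost i a = ∑ e, (G.load a e : ℝ) * F e (G.load a e) := by
    simp only [userCost, hF]
    exact G.sum_users_eq_sum_resources a _
  rw [h2, ← sub_nonpos, ← Finset.sum_sub_distrib] at h1
  refine le_of_eq_of_le (Finset.sum_congr rfl fun e _ => ?_) h1
  ring

end CGame

theorem InClass.cost_add_tax {n m : ℕ} {b : Fin m → ℕ → ℝ} {G : CGame}
    (hG : InClass n m b Tmc G) (e : Fin G.R) (x : ℕ) :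
    G.cost e x + G.tax e x = marginal (G.cost e) x := by
  rw [hG.2.2, add_Tmc_eq_marginal]

/-- Smoothness of the resource costs bounds the inefficiency of every equilibrium. -/
theorem InClass.mul_SC_le {n m : ℕ} {b : Fin m → ℕ → ℝ} {ρ ν : ℝ} (hν : 0 ≤ ν)
    (hsmooth : ∀ j, ∀ x y z : ℕ, x ≤ n → y ≤ n → z ≤ x → z ≤ y → x + y ≤ z + n →
      0 ≤ (y : ℝ) * b j y - ρ * (x * b j x)
        + ν * (((x : ℝ) - z) * marginal (b j) x - ((y : ℝ) - z) * marginal (b j) (x + 1)))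
    {G : CGame} (hG : InClass n m b Tmc G) {a a' : G.Assign}
    (ha : G.IsNE a) (ha' : G.IsAssign a') : ρ * G.SC a ≤ G.SC a' := by
  have hNE := ha.sum_le ha' _ hG.cost_add_tax
  have key : ∀ e, 0 ≤ (G.load a' e : ℝ) * G.cost e (G.load a' e)
      - ρ * (G.load a e * G.cost e (G.load a e))
      + ν * (((G.load a e : ℝ) - G.overlap a a' e) * marginal (G.cost e) (G.load a e)
      - ((G.load a' e : ℝ) - G.overlap a a' e) * marginal (G.cost e) (G.load a e + 1)) := by
    intro e
    obtain ⟨α, hα, hcost⟩ := hG.2.1 e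
    rw [show G.cost e = fun x => ∑ j, α j * b j x from funext hcost]
    simp only [marginal_sum]
    have h := Finset.sum_nonneg fun j (_ : j ∈ Finset.univ) => mul_nonneg (hα j)
      (hsmooth j (G.load a e) (G.load a' e) (G.overlap a a' e)
        ((G.load_le a e).trans hG.1) ((G.load_le a' e).trans hG.1)
        (G.overlap_le_left a a' e) (G.overlap_le_right a a' e)
        ((G.load_add_load_le a a' e).trans (Nat.add_le_add_left hG.1 _)))
    refine h.trans_eq ?_
    simp only [Finset.mul_sum, ← Finset.sum_sub_distrib, ← Finset.sum_add_distrib]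
    exact Finset.sum_congr rfl fun j _ => by ring
  have hsum := Finset.sum_nonneg fun e (_ : e ∈ Finset.univ) => key e
  rw [Finset.sum_add_distrib, Finset.sum_sub_distrib, ← Finset.mul_sum, ← Finset.mul_sum,
    ← G.SC_eq_sum_resources, ← G.SC_eq_sum_resources] at hsum
  nlinarith [mul_nonneg hν (neg_nonneg.2 hNE)]

section CyclicGame

variable {n m : ℕ} [NeZero n]

/-- Resource types: a basis function, an equilibrium load and an optimal load. -/
abbrev ResType (n m : ℕ) : Type := Fin m × Fin (n + 1) × Fin (n + 1)

/-- Every resource type has `n` cyclically arranged copies. -/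
abbrev CyclicIdx (n m : ℕ) : Type := ResType n m × Fin n

/-- The enumeration of the resources of the cyclic game. -/
def cyclicEquiv (n m : ℕ) : CyclicIdx n m ≃ Fin (Fintype.card (CyclicIdx n m)) :=
  Fintype.equivFin _

/-- The equilibrium action of user `i` in the cyclic game. -/
def cyclicEq (n m : ℕ) [NeZero n] (i : Fin n) : Finset (Fin (Fintype.card (CyclicIdx n m))) :=
  Finset.univ.filter fun e =>
    (i + ((cyclicEquiv n m).symm e).2).val < ((cyclicEquiv n m).symm e).1.2.1.val

/-- The alternative action of user `i` in the cyclic game. -/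
def cyclicOpt (n m : ℕ) [NeZero n] (i : Fin n) : Finset (Fin (Fintype.card (CyclicIdx n m))) :=
  Finset.univ.filter fun e =>
    n ≤ (i + ((cyclicEquiv n m).symm e).2).val + ((cyclicEquiv n m).symm e).1.2.2.val

/-- The game in which each user chooses between a block of `x` and a block of `y` consecutive
copies out of the `n` cyclically arranged copies of every resource type `(j, x, y)`, the
resources of type `t` having cost `θ t · b_j`. -/
abbrev cyclicGame (n m : ℕ) [NeZero n] (b : Fin m → ℕ → ℝ) (θ : ResType n m → ℝ) : CGame where
  n := n
  R := Fintype.card (CyclicIdx n m)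
  act i := {cyclicEq n m i, cyclicOpt n m i}
  act_ne _ := Finset.insert_nonempty _ _
  cost e x := θ ((cyclicEquiv n m).symm e).1 * b ((cyclicEquiv n m).symm e).1.1 x
  tax e := Tmc fun x => θ ((cyclicEquiv n m).symm e).1 * b ((cyclicEquiv n m).symm e).1.1 x

theorem cyclicGame_inClass (b : Fin m → ℕ → ℝ) (θ : ResType n m → ℝ) (hθ : ∀ t, 0 ≤ θ t) :
    InClass n m b Tmc (cyclicGame n m b θ) := by
  refine ⟨le_rfl, fun e => ?_, fun e x => rfl⟩
  refine ⟨Pi.single ((cyclicEquiv n m).symm e).1.1 (θ ((cyclicEquiv n m).symm e).1),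
    fun j => ?_, fun x => ?_⟩
  · exact (Pi.single_nonneg (α := fun _ : Fin m => ℝ)).2 (hθ _) j
  · simp [Pi.single_apply]

theorem card_filter_val_mem_Ico {n l u : ℕ} (hu : u ≤ n) :
    (Finset.univ.filter fun i : Fin n => l ≤ i.val ∧ i.val < u).card = u - l := by
  rw [← Nat.card_Ico, ← Finset.card_map Fin.valEmbedding]
  congr 1
  ext k
  simp only [Finset.mem_map, Finset.mem_filter, Finset.mem_univ, true_and,
    Fin.valEmbedding_apply, Finset.mem_Ico]
  exact ⟨fun ⟨i, hi, hk⟩ => hk ▸ hi, fun hk => ⟨⟨k, by omega⟩, hk, rfl⟩⟩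

theorem card_filter_val_lt_le {n x : ℕ} (hx : x ≤ n) :
    (Finset.univ.filter fun i : Fin n => i.val < x).card = x := by
  simpa using card_filter_val_mem_Ico (l := 0) hx

theorem card_filter_le_val_add {n y : ℕ} (hy : y ≤ n) :
    (Finset.univ.filter fun i : Fin n => n ≤ i.val + y).card = y := by
  refine Eq.trans ?_ ((card_filter_val_mem_Ico (l := n - y) (le_refl n)).trans
    (Nat.sub_sub_self hy))
  congr 1
  ext i
  simp

theorem card_filter_val_lt_and_le_val_add {n x y : ℕ} (hx : x ≤ n) (hy : y ≤ n) :
    (Finset.univ.filter fun i : Fin n => i.val < x ∧ n ≤ i.val + y).card = x + y - n := by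
  have h := card_filter_val_mem_Ico (l := n - y) hx
  rw [show x + y - n = x - (n - y) by omega, ← h]
  congr 1
  ext i
  simp [and_comm]

theorem card_filter_add_right (P : Fin n → Prop) [DecidablePred P] (k : Fin n) :
    (Finset.univ.filter fun i => P (i + k)).card = (Finset.univ.filter P).card :=
  Finset.card_equiv (Equiv.addRight k) fun i => by simp

theorem sum_ite_add_left (P : Fin n → Prop) [DecidablePred P] (i : Fin n) (c : ℝ) :
    ∑ k, (if P (i + k) then c else 0) = (Finset.univ.filter P).card * c := by
  refine (Equiv.sum_comp (Equiv.addLeft i) fun k => if P k then c else 0).trans ?_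
  rw [← Finset.sum_filter, Finset.sum_const, nsmul_eq_mul]

theorem load_cyclicEq (b : Fin m → ℕ → ℝ) (θ : ResType n m → ℝ)
    (e : Fin (Fintype.card (CyclicIdx n m))) :
    (cyclicGame n m b θ).load (cyclicEq n m) e = ((cyclicEquiv n m).symm e).1.2.1.val := by
  set q := (cyclicEquiv n m).symm e with hq
  have h := card_filter_add_right (fun i : Fin n => i.val < q.1.2.1.val) q.2
  rw [card_filter_val_lt_le q.1.2.1.is_le] at h
  refine Eq.trans (congrArg Finset.card ?_) h
  ext i
  simp [cyclicEq, hq]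

theorem load_cyclicOpt (b : Fin m → ℕ → ℝ) (θ : ResType n m → ℝ)
    (e : Fin (Fintype.card (CyclicIdx n m))) :
    (cyclicGame n m b θ).load (cyclicOpt n m) e = ((cyclicEquiv n m).symm e).1.2.2.val := by
  set q := (cyclicEquiv n m).symm e with hq
  have h := card_filter_add_right (fun i : Fin n => n ≤ i.val + q.1.2.2.val) q.2
  rw [card_filter_le_val_add q.1.2.2.is_le] at h
  refine Eq.trans (congrArg Finset.card ?_) h
  ext i
  simp [cyclicOpt, hq]

theorem sum_cyclicEquiv_symm {n m : ℕ} (u : CyclicIdx n m → ℝ) :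
    ∑ e, u ((cyclicEquiv n m).symm e) = ∑ t, ∑ k, u (t, k) := by
  rw [Equiv.sum_comp (cyclicEquiv n m).symm u, Fintype.sum_prod_type]

theorem SC_cyclicEq (b : Fin m → ℕ → ℝ) (θ : ResType n m → ℝ) :
    (cyclicGame n m b θ).SC (cyclicEq n m) =
      n * ∑ t : ResType n m, θ t * ((t.2.1.val : ℝ) * b t.1 t.2.1.val) := by
  rw [CGame.SC_eq_sum_resources]
  simp only [load_cyclicEq]
  refine (sum_cyclicEquiv_symm fun q =>
    (q.1.2.1.val : ℝ) * (θ q.1 * b q.1.1 q.1.2.1.val)).trans ?_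
  simp only [Finset.sum_const, Finset.card_univ, Fintype.card_fin, nsmul_eq_mul, Finset.mul_sum]
  exact Finset.sum_congr rfl fun t _ => by ring

theorem SC_cyclicOpt (b : Fin m → ℕ → ℝ) (θ : ResType n m → ℝ) :
    (cyclicGame n m b θ).SC (cyclicOpt n m) =
      n * ∑ t : ResType n m, θ t * ((t.2.2.val : ℝ) * b t.1 t.2.2.val) := by
  rw [CGame.SC_eq_sum_resources]
  simp only [load_cyclicOpt]
  refine (sum_cyclicEquiv_symm fun q =>
    (q.1.2.2.val : ℝ) * (θ q.1 * b q.1.1 q.1.2.2.val)).trans ?_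
  simp only [Finset.sum_const, Finset.card_univ, Fintype.card_fin, nsmul_eq_mul, Finset.mul_sum]
  exact Finset.sum_congr rfl fun t _ => by ring

theorem cyclicGame_cost_add_tax (b : Fin m → ℕ → ℝ) (θ : ResType n m → ℝ)
    (e : Fin (Fintype.card (CyclicIdx n m))) (x : ℕ) :
    (cyclicGame n m b θ).cost e x + (cyclicGame n m b θ).tax e x =
      θ ((cyclicEquiv n m).symm e).1 * marginal (b ((cyclicEquiv n m).symm e).1.1) x := by
  rw [← marginal_mul]
  exact add_Tmc_eq_marginal _ x

theorem userCost_cyclicEq (b : Fin m → ℕ → ℝ) (θ : ResType n m → ℝ) (i : Fin n) :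
    (cyclicGame n m b θ).userCost i (cyclicEq n m) =
      ∑ t : ResType n m, θ t * ((t.2.1.val : ℝ) * marginal (b t.1) t.2.1.val) := by
  refine (Finset.sum_congr rfl fun e _ => cyclicGame_cost_add_tax b θ e _).trans ?_
  simp only [load_cyclicEq]
  rw [cyclicEq, Finset.sum_filter]
  refine (sum_cyclicEquiv_symm fun q => if (i + q.2).val < q.1.2.1.val then
    θ q.1 * marginal (b q.1.1) q.1.2.1.val else 0).trans ?_
  refine Finset.sum_congr rfl fun t _ => ?_
  dsimp only
  rw [sum_ite_add_left (fun k : Fin n => k.val < t.2.1.val), card_filter_val_lt_le t.2.1.is_le]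
  ring

theorem userCost_update_cyclicOpt (b : Fin m → ℕ → ℝ) (θ : ResType n m → ℝ) (i : Fin n) :
    (cyclicGame n m b θ).userCost i
        (Function.update (cyclicEq n m) i (cyclicOpt n m i)) =
      ∑ t : ResType n m, θ t * (((t.2.1.val + t.2.2.val - n : ℕ) : ℝ)
          * (marginal (b t.1) t.2.1.val - marginal (b t.1) (t.2.1.val + 1))
        + (t.2.2.val : ℝ) * marginal (b t.1) (t.2.1.val + 1)) := by
  rw [(cyclicGame n m b θ).userCost_update (cyclicEq n m) i (cyclicOpt n m i) _
    (cyclicGame_cost_add_tax b θ)]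
  simp only [load_cyclicEq, cyclicEq, cyclicOpt, Finset.mem_filter, Finset.mem_univ, true_and]
  refine (sum_cyclicEquiv_symm fun q =>
    (if (i + q.2).val < q.1.2.1.val ∧ n ≤ (i + q.2).val + q.1.2.2.val then
      θ q.1 * marginal (b q.1.1) q.1.2.1.val - θ q.1 * marginal (b q.1.1) (q.1.2.1.val + 1)
      else 0) + if n ≤ (i + q.2).val + q.1.2.2.val then
      θ q.1 * marginal (b q.1.1) (q.1.2.1.val + 1) else 0).trans ?_
  refine Finset.sum_congr rfl fun t _ => ?_
  dsimp only
  rw [Finset.sum_add_distrib,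
    sum_ite_add_left (fun k : Fin n => k.val < t.2.1.val ∧ n ≤ k.val + t.2.2.val),
    sum_ite_add_left (fun k : Fin n => n ≤ k.val + t.2.2.val),
    card_filter_val_lt_and_le_val_add t.2.1.is_le t.2.2.is_le,
    card_filter_le_val_add t.2.2.is_le]
  ring

theorem cyclicEq_isNE (b : Fin m → ℕ → ℝ) (θ : ResType n m → ℝ)
    (h : ∑ t : ResType n m, θ t *
      (((t.2.1.val : ℝ) - (t.2.1.val + t.2.2.val - n : ℕ)) * marginal (b t.1) t.2.1.val
      - ((t.2.2.val : ℝ) - (t.2.1.val + t.2.2.val - n : ℕ))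
        * marginal (b t.1) (t.2.1.val + 1)) ≤ 0) :
    (cyclicGame n m b θ).IsNE (cyclicEq n m) := by
  refine ⟨fun i => Finset.mem_insert_self _ _, fun i s hs => ?_⟩
  rcases Finset.mem_insert.1 hs with rfl | hs
  · exact le_of_eq (congrArg _ (Function.update_eq_self i (cyclicEq n m)).symm)
  · rw [Finset.mem_singleton.1 hs]
    refine (userCost_cyclicEq b θ i).trans_le (le_of_le_of_eq ?_
      (userCost_update_cyclicOpt b θ i).symm)
    rw [← sub_nonpos, ← Finset.sum_sub_distrib]
    refine le_of_eq_of_le (Finset.sum_congr rfl fun t _ => ?_) h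
    ring

theorem cyclicOpt_isAssign (b : Fin m → ℕ → ℝ) (θ : ResType n m → ℝ) :
    (cyclicGame n m b θ).IsAssign (cyclicOpt n m) := fun _ =>
  Finset.mem_insert_of_mem (Finset.mem_singleton_self _)

end CyclicGame

theorem PoA_le_of_mul_SC_le {n m : ℕ} {b : Fin m → ℕ → ℝ} {T : Mech} {ρ : ℝ} (hρ : 0 < ρ)
    (h : ∀ G : CGame, InClass n m b T G → ∀ a a' : G.Assign, G.IsNE a → G.IsAssign a' →
      ρ * G.SC a ≤ G.SC a') : PoA n m b T ≤ ENNReal.ofReal (1 / ρ) := by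
  refine iSup_le fun G => iSup_le fun hG => iSup_le fun a => iSup_le fun ha =>
    ENNReal.ofReal_le_ofReal ?_
  rw [div_le_div_iff₀ hG.2 hρ, one_mul, mul_comm]
  refine le_csInf ⟨_, a, ha.1, rfl⟩ ?_
  rintro _ ⟨a', ha', rfl⟩
  exact h G hG.1 a a' ha ha'

/-- A game with an equilibrium `a` and an assignment `a'` of much smaller cost bounds the price
of anarchy from below, provided the price of anarchy is known to be finite. -/
theorem le_PoA_of_SC_lt {n m : ℕ} {b : Fin m → ℕ → ℝ} {T : Mech} {ρ r : ℝ} (hρ : 0 < ρ)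
    (hr : 0 < r)
    (h : ∀ G : CGame, InClass n m b T G → ∀ a a' : G.Assign, G.IsNE a → G.IsAssign a' →
      ρ * G.SC a ≤ G.SC a')
    {G : CGame} (hG : InClass n m b T G) {a a' : G.Assign} (ha : G.IsNE a)
    (ha' : G.IsAssign a') (hpos : 0 < G.SC a) (hlt : G.SC a' ≤ r * G.SC a) :
    ENNReal.ofReal (1 / r) ≤ PoA n m b T := by
  have hlb : ρ * G.SC a ∈ lowerBounds {c | ∃ a, G.IsAssign a ∧ G.SC a = c} := by
    rintro _ ⟨a'', ha'', rfl⟩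
    exact h G hG a a'' ha ha''
  have hmin : 0 < G.MinCost :=
    (mul_pos hρ hpos).trans_le (le_csInf ⟨_, a, ha.1, rfl⟩ hlb)
  have hle : G.MinCost ≤ G.SC a' := csInf_le ⟨_, hlb⟩ ⟨a', ha', rfl⟩
  refine le_trans (ENNReal.ofReal_le_ofReal ?_) (le_iSup_of_le G (le_iSup_of_le ⟨hG, hmin⟩
    (le_iSup_of_le a (le_iSup_of_le ha le_rfl))))
  rw [div_le_div_iff₀ hr hmin]
  linarith

section LinearProgram

variable {n m : ℕ} {b : Fin m → ℕ → ℝ}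

/-- The coefficient of `ν` in the constraint `(x, y)` for the cost function `f`. -/
def slack (n : ℕ) (f : ℕ → ℝ) (x y : ℕ) : ℝ :=
  ((x : ℝ) - (x + y - n : ℕ)) * marginal f x - ((y : ℝ) - (x + y - n : ℕ)) * marginal f (x + 1)

/-- The boundary conventions for `F` are immaterial in the constraints. -/
theorem slack_eq {f F : ℕ → ℝ}
    (hF : ∀ x : ℕ, 1 ≤ x → x ≤ n → F x = (x : ℝ) * f x - ((x : ℝ) - 1) * f (x - 1))
    {x y : ℕ} (hx : x ≤ n) (hy : y ≤ n) :
    ((x : ℝ) - (x + y - n : ℕ)) * F x - ((y : ℝ) - (x + y - n : ℕ)) * F (x + 1)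
      = slack n f x y := by
  have h1 : ((x : ℝ) - (x + y - n : ℕ)) * F x = ((x : ℝ) - (x + y - n : ℕ)) * marginal f x := by
    rcases Nat.eq_zero_or_pos x with rfl | hx0
    · simp [Nat.sub_eq_zero_of_le hy]
    · rw [hF x hx0 hx, marginal]
  have h2 : ((y : ℝ) - (x + y - n : ℕ)) * F (x + 1)
      = ((y : ℝ) - (x + y - n : ℕ)) * marginal f (x + 1) := by
    rcases hx.eq_or_lt with rfl | hx'
    · simp
    · rw [hF (x + 1) (by omega) hx', marginal]
  rw [h1, h2, slack]

/-- The constraint with the smallest overlap `z` implies those with a larger overlap. -/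
theorem slack_le {f : ℕ → ℝ} (h0 : f 0 = 0) (hpos : ∀ x, 1 ≤ x → x ≤ n → 0 < f x)
    (hconv : ∀ x, 1 ≤ x → x + 1 ≤ n → f x - f (x - 1) ≤ f (x + 1) - f x)
    {x y z : ℕ} (hx : x ≤ n) (hzy : z ≤ y) (hz : x + y ≤ z + n) :
    slack n f x y ≤
      ((x : ℝ) - z) * marginal f x - ((y : ℝ) - z) * marginal f (x + 1) := by
  rw [slack]
  rcases hx.eq_or_lt with rfl | hx'
  · rw [show z = y by omega]; simp
  · have h1 := marginal_le_succ h0 hpos hconv x hx'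
    have h2 : ((x + y - n : ℕ) : ℝ) ≤ z := Nat.cast_le.2 (by omega)
    nlinarith [mul_nonneg (sub_nonneg.2 h1) (sub_nonneg.2 h2)]

/-- The linear program has a feasible point with positive objective value. -/
theorem exists_feasible_pos (hb0 : ∀ j, b j 0 = 0)
    (hbpos : ∀ j, ∀ x : ℕ, 1 ≤ x → x ≤ n → 0 < b j x)
    (hbconv : ∀ j, ∀ x : ℕ, 1 ≤ x → x + 1 ≤ n → b j x - b j (x - 1) ≤ b j (x + 1) - b j x) :
    ∃ ρ ν : ℝ, 0 < ρ ∧ 0 ≤ ν ∧ ∀ t : ResType n m,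
      0 ≤ (t.2.2.val : ℝ) * b t.1 t.2.2.val - ρ * (t.2.1.val * b t.1 t.2.1.val)
        + ν * slack n (b t.1) t.2.1.val t.2.2.val := by
  have hν : ∀ᶠ ν : ℝ in nhdsWithin 0 (Set.Ioi 0), ∀ t : ResType n m, 0 < t.2.1.val →
      0 < (t.2.2.val : ℝ) * b t.1 t.2.2.val + ν * slack n (b t.1) t.2.1.val t.2.2.val := by
    rw [Filter.eventually_all]
    rintro ⟨j, x, y⟩
    dsimp only
    rcases Nat.eq_zero_or_pos y.val with hy | hy
    · filter_upwards [self_mem_nhdsWithin] with ν (hν : 0 < ν) hx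
      have h1 := marginal_pos (hb0 j) (hbpos j) (hbconv j) x.val hx x.is_le
      have h2 : (0 : ℝ) < x.val := Nat.cast_pos.2 hx
      simp only [hy, slack, add_zero, Nat.sub_eq_zero_of_le x.is_le]
      simp only [Nat.cast_zero, zero_mul, sub_zero, zero_add]
      positivity
    · have h1 : 0 < (y.val : ℝ) * b j y.val :=
        mul_pos (Nat.cast_pos.2 hy) (hbpos j _ hy y.is_le)
      have h2 : Filter.Tendsto
          (fun ν : ℝ => (y.val : ℝ) * b j y.val + ν * slack n (b j) x.val y.val)
          (nhdsWithin 0 (Set.Ioi 0)) (nhds ((y.val : ℝ) * b j y.val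
            + 0 * slack n (b j) x.val y.val)) :=
        (Continuous.tendsto (by fun_prop) 0).mono_left nhdsWithin_le_nhds
      filter_upwards [h2.eventually_const_lt (by simpa using h1)] with ν hν _ using hν
  obtain ⟨ν, hν, hν0, hν1⟩ := (hν.and (Ioo_mem_nhdsGT (zero_lt_one' ℝ))).exists
  have hρ : ∀ᶠ ρ : ℝ in nhdsWithin 0 (Set.Ioi 0), ∀ t : ResType n m,
      0 ≤ (t.2.2.val : ℝ) * b t.1 t.2.2.val - ρ * (t.2.1.val * b t.1 t.2.1.val)
        + ν * slack n (b t.1) t.2.1.val t.2.2.val := by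
    rw [Filter.eventually_all]
    intro t
    rcases Nat.eq_zero_or_pos t.2.1.val with hx | hx
    · refine Filter.Eventually.of_forall fun ρ => ?_
      simp only [hx, slack, zero_add, Nat.sub_eq_zero_of_le t.2.2.is_le]
      rcases Nat.eq_zero_or_pos t.2.2.val with hy | hy
      · simp [hy]
      · have h1 := apply_one_le_of_convex (hb0 t.1) (hbpos t.1) (hbconv t.1) _ hy t.2.2.is_le
        have h2 := hbpos t.1 1 le_rfl (hy.trans_le t.2.2.is_le)
        have h3 : marginal (b t.1) 1 = b t.1 1 := by simp [marginal]
        have h4 : ν * b t.1 1 ≤ b t.1 t.2.2.val := by nlinarith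
        rw [h3]
        have h5 := mul_le_mul_of_nonneg_left h4 (Nat.cast_nonneg (α := ℝ) t.2.2.val)
        simp only [Nat.cast_zero, zero_mul, mul_zero, sub_zero, zero_sub]
        linarith
    · have h2 : Filter.Tendsto (fun ρ : ℝ => (t.2.2.val : ℝ) * b t.1 t.2.2.val
            - ρ * (t.2.1.val * b t.1 t.2.1.val) + ν * slack n (b t.1) t.2.1.val t.2.2.val)
          (nhdsWithin 0 (Set.Ioi 0)) (nhds ((t.2.2.val : ℝ) * b t.1 t.2.2.val
            - 0 * (t.2.1.val * b t.1 t.2.1.val)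
            + ν * slack n (b t.1) t.2.1.val t.2.2.val)) :=
        (Continuous.tendsto (by fun_prop) 0).mono_left nhdsWithin_le_nhds
      filter_upwards [h2.eventually_const_lt (by simpa using hν t hx)] with ρ hρ using hρ.le
  obtain ⟨ρ, hρ, hρ0⟩ := (hρ.and self_mem_nhdsWithin).exists
  exact ⟨ρ, ν, hρ0, hν0.le, hρ⟩

end LinearProgram

/-- Over congestion games with at most `n` users and costs
generated by positive, convex basis functions: let
`F^mc_j(x) = x·b_j(x) − (x−1)·b_j(x−1)` on `{1,…,n}` with
`F^mc_j(0) = F^mc_j(n+1) = 0`, and let `ρ^mc` be the optimal value of the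
linear program maximizing `ρ` over `ρ ∈ ℝ`, `ν ≥ 0` subject to
`b_j(y)·y − ρ·b_j(x)·x + ν·[(x−z)·F^mc_j(x) − (y−z)·F^mc_j(x+1)] ≥ 0` for all
`j` and all `x, y ∈ {0,…,n}` with `x+y ≥ 1`, where `z = max{0, x+y−n}`.
Then the marginal cost mechanism satisfies `PoA(T^mc) = 1/ρ^mc`. -/
theorem marginal_cost_PoA
    (n m : ℕ) (hn : 0 < n) (hm : 0 < m)
    (b : Fin m → ℕ → ℝ)
    (hb0 : ∀ j, b j 0 = 0)
    (hbpos : ∀ j, ∀ x : ℕ, 1 ≤ x → x ≤ n → 0 < b j x)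
    (hbconv : ∀ j, ∀ x : ℕ, 1 ≤ x → x + 1 ≤ n →
      b j x - b j (x - 1) ≤ b j (x + 1) - b j x)
    (Fmc : Fin m → ℕ → ℝ)
    (hFmc : ∀ j, ∀ x : ℕ, 1 ≤ x → x ≤ n →
      Fmc j x = (x : ℝ) * b j x - ((x : ℝ) - 1) * b j (x - 1))
    (hFmc0 : ∀ j, Fmc j 0 = 0) (hFmcn1 : ∀ j, Fmc j (n + 1) = 0)
    (ρmc : ℝ)
    (hρmc : IsGreatest
      {ρ : ℝ | ∃ ν : ℝ, 0 ≤ ν ∧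
        ∀ j : Fin m, ∀ x y : ℕ, x ≤ n → y ≤ n → 1 ≤ x + y →
          b j y * y - ρ * (b j x * x)
            + ν * ((((x : ℝ) - ((x + y - n : ℕ) : ℝ)) * Fmc j x)
                - (((y : ℝ) - ((x + y - n : ℕ) : ℝ)) * Fmc j (x + 1))) ≥ 0}
      ρmc) :
    PoA n m b Tmc = ENNReal.ofReal (1 / ρmc) := by
  have hfeas : ∀ r ν : ℝ,
      (∀ j : Fin m, ∀ x y : ℕ, x ≤ n → y ≤ n → 1 ≤ x + y →
        b j y * y - r * (b j x * x)
          + ν * ((((x : ℝ) - ((x + y - n : ℕ) : ℝ)) * Fmc j x)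
              - (((y : ℝ) - ((x + y - n : ℕ) : ℝ)) * Fmc j (x + 1))) ≥ 0) ↔
      ∀ t : ResType n m,
        0 ≤ (t.2.2.val : ℝ) * b t.1 t.2.2.val - r * (t.2.1.val * b t.1 t.2.1.val)
          + ν * slack n (b t.1) t.2.1.val t.2.2.val := by
    intro r ν
    constructor
    · rintro h ⟨j, x, y⟩
      dsimp only
      by_cases hxy : 1 ≤ x.val + y.val
      · have h1 := h j x y x.is_le y.is_le hxy
        rw [slack_eq (hFmc j) x.is_le y.is_le] at h1
        linarith
      · have hx : x.val = 0 := by omega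
        have hy : y.val = 0 := by omega
        simp [hx, hy, slack]
    · intro h j x y hx hy _
      rw [slack_eq (hFmc j) hx hy]
      have h1 := h (j, ⟨x, by omega⟩, ⟨y, by omega⟩)
      dsimp only at h1
      linarith
  obtain ⟨⟨ν, hν, hopt⟩, hub⟩ := hρmc
  have hρ : 0 < ρmc := by
    obtain ⟨ρ, ν', hρ, hν', h⟩ := exists_feasible_pos hb0 hbpos hbconv
    exact hρ.trans_le (hub ⟨ν', hν', (hfeas ρ ν').2 h⟩)
  have hsmooth : ∀ G : CGame, InClass n m b Tmc G → ∀ a a' : G.Assign, G.IsNE a →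
      G.IsAssign a' → ρmc * G.SC a ≤ G.SC a' := by
    intro G hG a a' ha ha'
    refine hG.mul_SC_le hν (fun j x y z hx hy _ hzy hz => ?_) ha ha'
    have h1 := (hfeas ρmc ν).1 hopt (j, ⟨x, by omega⟩, ⟨y, by omega⟩)
    have h2 := mul_le_mul_of_nonneg_left
      (slack_le (hb0 j) (hbpos j) (hbconv j) hx hzy hz) hν
    dsimp only at h1
    linarith
  refine le_antisymm (PoA_le_of_mul_SC_le hρ hsmooth) ?_
  have hlower : ∀ r : ℝ, ρmc < r → ENNReal.ofReal (1 / r) ≤ PoA n m b Tmc := by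
    intro r hr
    have hr0 : 0 < r := hρ.trans hr
    have : NeZero n := ⟨hn.ne'⟩
    obtain ⟨θ, hθ, hθB, hθd⟩ := exists_weights_of_infeasible
      (fun t : ResType n m =>
        (t.2.2.val : ℝ) * b t.1 t.2.2.val - r * (t.2.1.val * b t.1 t.2.1.val))
      (fun t => slack n (b t.1) t.2.1.val t.2.2.val) (fun ν' hν' => by
        by_contra hcon
        push Not at hcon
        exact absurd (hub ⟨ν', hν', (hfeas r ν').2 hcon⟩) (not_le.2 hr))
    have hn' : (0 : ℝ) < n := Nat.cast_pos.2 hn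
    have hlt : (cyclicGame n m b θ).SC (cyclicOpt n m)
        < r * (cyclicGame n m b θ).SC (cyclicEq n m) := by
      rw [SC_cyclicEq, SC_cyclicOpt, mul_left_comm]
      refine mul_lt_mul_of_pos_left ?_ hn'
      rw [← sub_neg, Finset.mul_sum, ← Finset.sum_sub_distrib]
      refine lt_of_eq_of_lt (Finset.sum_congr rfl fun t _ => ?_) hθd
      ring
    have hnonneg : 0 ≤ (cyclicGame n m b θ).SC (cyclicOpt n m) := by
      rw [SC_cyclicOpt]
      refine mul_nonneg hn'.le (Finset.sum_nonneg fun t _ => mul_nonneg (hθ t) ?_)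
      rcases Nat.eq_zero_or_pos t.2.2.val with hy | hy
      · simp [hy]
      · exact mul_nonneg (Nat.cast_nonneg _) (hbpos t.1 _ hy t.2.2.is_le).le
    have hpos : 0 < (cyclicGame n m b θ).SC (cyclicEq n m) :=
      pos_of_mul_pos_right (hnonneg.trans_lt hlt) hr0.le
    exact le_PoA_of_SC_lt hρ hr0 hsmooth (cyclicGame_inClass b θ hθ) (cyclicEq_isNE b θ hθB)
      (cyclicOpt_isAssign b θ) hpos hlt.le
  have htend : Filter.Tendsto (fun r : ℝ => ENNReal.ofReal (1 / r))
      (nhdsWithin ρmc (Set.Ioi ρmc)) (nhds (ENNReal.ofReal (1 / ρmc))) :=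
    ENNReal.tendsto_ofReal ((tendsto_const_nhds.div Filter.tendsto_id hρ.ne').mono_left
      nhdsWithin_le_nhds)
  exact le_of_tendsto htend (Filter.eventually_of_mem self_mem_nhdsWithin hlower)
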